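/- arXiv:2503.18169 — 2 statements merged into one kernel-verified Lean document; each statement's English description precedes it below -/
import Mathlib

section
/- Let ((x_i,y_i))_{i∈I} be a Lipschitz interpolating set for Lip_0(X) whose Lipschitz interpolation constant equals 1 (equivalently, the molecules (m_{x_i,y_i})_{i∈I} are isometrically equivalent to the unit vector basis of ℓ_1(I)). Then there exists a Beurling set of functions in Lip_0(X) for ((x_i,y_i))_{i∈I}; in particular, the closed span of (m_{x_i,y_i})_{i∈I} is 1-complemented in F(X). -/
open Finset in
theorem z2 {V : Type*} (s : V →₀ ZMod 2) : s + s = 0 := by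
  ext v; simp [CharTwo.add_self_eq_zero]

/-- evaluation of a mod 2 chain on a set -/
noncomputable def phi {V : Type*} (S : V → Bool) : (V →₀ ZMod 2) →+ ZMod 2 :=
  Finsupp.liftAddHom (fun v => if S v then AddMonoidHom.id _ else 0)

theorem phi_single {V : Type*} (S : V → Bool) (v : V) (a : ZMod 2) :
    phi S (Finsupp.single v a) = if S v then a else 0 := by
  unfold phi
  rw [Finsupp.liftAddHom_apply_single]
  split_ifs <;> simp

theorem phi_pair {V : Type*} (S : V → Bool) (u v : V) :
    phi S (Finsupp.single u 1 + Finsupp.single v 1) = if S u ≠ S v then 1 else 0 := by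
  rw [map_add, phi_single, phi_single]
  cases S u <;> cases S v <;> simp
  exact CharTwo.add_self_eq_zero 1

theorem phi_mapDomain {V W : Type*} (S : W → Bool) (f : V → W) (T : V →₀ ZMod 2) :
    phi S (T.mapDomain f) = phi (S ∘ f) T := by
  induction T using Finsupp.induction_linear with
  | zero => simp
  | add a b ha hb => simp [Finsupp.mapDomain_add, ha, hb]
  | single a b => simp [Finsupp.mapDomain_single, phi_single]

/-- mod 2 boundary -/
noncomputable def bd {V E : Type*} (p q : E → V) (A : Finset E) : V →₀ ZMod 2 :=
  ∑ e ∈ A, (Finsupp.single (p e) 1 + Finsupp.single (q e) 1)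

theorem bd_symmDiff {V E : Type*} [DecidableEq E] (p q : E → V) (A B : Finset E) :
    bd p q (symmDiff A B) = bd p q A + bd p q B := by
  have h1 : bd p q A = bd p q (A \ B) + bd p q (A ∩ B) := by
    unfold bd
    rw [← Finset.sum_union (Finset.disjoint_sdiff_inter A B), Finset.sdiff_union_inter]
  have h2 : bd p q B = bd p q (B \ A) + bd p q (A ∩ B) := by
    unfold bd
    rw [Finset.inter_comm A B, ← Finset.sum_union (Finset.disjoint_sdiff_inter B A),
      Finset.sdiff_union_inter]
  have h3 : bd p q (symmDiff A B) = bd p q (A \ B) + bd p q (B \ A) := by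
    unfold bd
    rw [← Finset.sum_union disjoint_sdiff_sdiff]
    rfl
  rw [h1, h2, h3, add_add_add_comm, z2, add_zero]

theorem bd_singleton {V E : Type*} (p q : E → V) (e : E) :
    bd p q {e} = Finsupp.single (p e) 1 + Finsupp.single (q e) 1 := by
  simp [bd]

theorem phi_bd_ne {V E : Type*} (p q : E → V) (S : V → Bool) (A : Finset E)
    (h : phi S (bd p q A) ≠ 0) : ∃ e ∈ A, S (p e) ≠ S (q e) := by
  by_contra! hc
  apply h
  unfold bd
  rw [map_sum]
  refine Finset.sum_eq_zero fun e he => ?_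
  rw [phi_pair, if_neg]
  simpa using hc e he

open Classical in
/-- path lemma -/
theorem path_lemma {V E : Type*} (p q : E → V) (A : Finset E) (s t : V)
    (hA : bd p q A = Finsupp.single s 1 + Finsupp.single t 1) :
    ∃ P ⊆ A, bd p q P = Finsupp.single s 1 + Finsupp.single t 1 ∧
      ∀ e ∈ P, ∀ e' ∈ P, decide (p e = t) ≠ decide (q e = t) →
        decide (p e' = t) ≠ decide (q e' = t) → e = e' := by
  set Q := A.filter (fun e => decide (p e = t) = decide (q e = t)) with hQ
  let R : V → Bool := fun v => decide (∃ W ⊆ Q, bd p q W = Finsupp.single s 1 + Finsupp.single v 1)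
  have hQA : Q ⊆ A := Finset.filter_subset _ _
  by_cases ht : R t
  · obtain ⟨W, hW, hb⟩ := of_decide_eq_true ht
    refine ⟨W, hW.trans hQA, hb, ?_⟩
    intro e he e' _ h1
    exact absurd (Finset.mem_filter.1 (hW he)).2 h1
  · have hs : R s = true := by
      apply decide_eq_true
      exact ⟨∅, by simp, by rw [z2]; simp [bd]⟩
    have hcl : ∀ e ∈ Q, R (p e) = R (q e) := by
      intro e he
      apply decide_eq_decide.2
      constructor
      · rintro ⟨W, hW, hb⟩
        refine ⟨symmDiff W {e}, ?_, ?_⟩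
        · intro x hx
          rcases Finset.mem_symmDiff.1 hx with h | h
          · exact hW h.1
          · rw [Finset.mem_singleton.1 h.1]; exact he
        · rw [bd_symmDiff, hb, bd_singleton]
          have := z2 (Finsupp.single (p e) (1 : ZMod 2))
          calc _ = Finsupp.single s (1 : ZMod 2) + (Finsupp.single (p e) (1 : ZMod 2) + Finsupp.single (p e) (1 : ZMod 2)) + Finsupp.single (q e) 1 := by abel
            _ = _ := by rw [this, add_zero]
      · rintro ⟨W, hW, hb⟩
        refine ⟨symmDiff W {e}, ?_, ?_⟩
        · intro x hx
          rcases Finset.mem_symmDiff.1 hx with h | h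
          · exact hW h.1
          · rw [Finset.mem_singleton.1 h.1]; exact he
        · rw [bd_symmDiff, hb, bd_singleton]
          have := z2 (Finsupp.single (q e) (1 : ZMod 2))
          calc _ = Finsupp.single s (1 : ZMod 2) + (Finsupp.single (q e) (1 : ZMod 2) + Finsupp.single (q e) (1 : ZMod 2)) + Finsupp.single (p e) 1 := by abel
            _ = _ := by rw [this, add_zero]
    have hne : phi R (bd p q A) ≠ 0 := by
      rw [hA, phi_pair, if_pos]
      · simp
      · rw [hs]; exact fun h => ht h.symm
    obtain ⟨e, heA, hcr⟩ := phi_bd_ne p q R A hne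
    have heQ : e ∉ Q := fun h => hcr (hcl e h)
    have hst : decide (p e = t) ≠ decide (q e = t) := by
      intro h; exact heQ (Finset.mem_filter.2 ⟨heA, h⟩)
    have key : ∃ c, R c = true ∧ Finsupp.single (p e) (1 : ZMod 2) + Finsupp.single (q e) 1
        = Finsupp.single c 1 + Finsupp.single t 1 := by
      by_cases hp : p e = t
      · refine ⟨q e, ?_, by rw [hp, add_comm]⟩
        rw [hp] at hcr
        simpa [ht] using hcr
      · have hq : q e = t := by
          by_contra hq; simp [hp, hq] at hst
        refine ⟨p e, ?_, by rw [hq]⟩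
        rw [hq] at hcr
        simpa [ht] using hcr
    obtain ⟨c, hc, hce⟩ := key
    obtain ⟨W, hW, hb⟩ := of_decide_eq_true hc
    have heW : e ∉ W := fun h => heQ (hW h)
    refine ⟨insert e W, ?_, ?_, ?_⟩
    · intro x hx
      rcases Finset.mem_insert.1 hx with h | h
      · rw [h]; exact heA
      · exact hQA (hW h)
    · have : bd p q (insert e W) = bd p q {e} + bd p q W := by
        unfold bd; rw [Finset.sum_insert heW, Finset.sum_singleton]
      rw [this, hb, bd_singleton, hce]
      calc _ = (Finsupp.single c (1 : ZMod 2) + Finsupp.single c 1) + (Finsupp.single s 1 + Finsupp.single t 1) := by abel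
        _ = _ := by rw [z2, zero_add]
    · have hWn : ∀ x ∈ insert e W, decide (p x = t) ≠ decide (q x = t) → x = e := by
        intro x hx h
        rcases Finset.mem_insert.1 hx with h' | h'
        · exact h'
        · exact absurd (Finset.mem_filter.1 (hW h')).2 h
      intro e1 h1 e2 h2 h3 h4
      rw [hWn e1 h1 h3, hWn e2 h2 h4]

open Classical in
/-- The star step. -/
theorem star_step {V E : Type*} [Fintype V] [Fintype E] (p q : E → V) (c : E → ℝ)
    (T : V →₀ ZMod 2) (M : ℝ) (hM : 0 < M) (hpos : ∀ e, p e ≠ q e → 0 < c e)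
    (hJ : ∃ A, bd p q A = T) (hT : ∀ A, bd p q A = T → M ≤ ∑ e ∈ A, c e) :
    ∃ S : V → Bool, ∃ t : ℝ, 0 < t ∧ phi S T = 1 ∧ (∀ e, S (p e) ≠ S (q e) → t ≤ c e) ∧ t ≤ M ∧
      ∀ A, bd p q A = T → M - t ≤ ∑ e ∈ A, (c e - if S (p e) ≠ S (q e) then t else 0) := by
  have hT0 : T ≠ 0 := by
    intro h
    have := hT ∅ (by rw [h]; simp [bd])
    simp at this; linarith
  obtain ⟨s, hs⟩ := Finsupp.ne_iff.1 hT0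
  have hs1 : T s = 1 := by
    have : ∀ a : ZMod 2, a ≠ 0 → a = 1 := by decide
    exact this _ hs
  obtain ⟨J0, hJ0⟩ := hJ
  -- minimal (b, L)
  let Ω : Finset (V × Finset E) := Finset.univ.filter
    (fun w => bd p q w.2 = T + (Finsupp.single s 1 + Finsupp.single w.1 1))
  have hΩ : Ω.Nonempty := ⟨(s, J0), by simp [Ω, hJ0, z2]⟩
  obtain ⟨⟨b, L⟩, hbL, hmin⟩ := Finset.exists_min_image Ω (fun w => ∑ e ∈ w.2, c e) hΩ
  have hbL' : bd p q L = T + (Finsupp.single s 1 + Finsupp.single b 1) := (Finset.mem_filter.1 hbL).2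
  have hmin' : ∀ b' L', bd p q L' = T + (Finsupp.single s 1 + Finsupp.single b' 1) →
      ∑ e ∈ L, c e ≤ ∑ e ∈ L', c e := fun b' L' h =>
    hmin (b', L') (Finset.mem_filter.2 ⟨Finset.mem_univ _, h⟩)
  let S : V → Bool := fun v => decide (v = b)
  -- claim A
  have clA : ∀ L', bd p q L' = T + (Finsupp.single s 1 + Finsupp.single b 1) →
      ∑ e ∈ L', c e = ∑ e ∈ L, c e → ∀ e ∈ L', S (p e) = S (q e) := by
    intro L' hL' hc e he
    by_contra hcr
    have hnl : p e ≠ q e := fun h => hcr (by rw [h])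
    have key : ∃ u, Finsupp.single (p e) (1 : ZMod 2) + Finsupp.single (q e) 1
        = Finsupp.single b 1 + Finsupp.single u 1 := by
      by_cases hp : p e = b
      · exact ⟨q e, by rw [hp]⟩
      · have hq : q e = b := by
          by_contra hq; simp [S, hp, hq] at hcr
        exact ⟨p e, by rw [hq, add_comm]⟩
    obtain ⟨u, hu⟩ := key
    have h1 : bd p q (symmDiff L' {e}) = T + (Finsupp.single s 1 + Finsupp.single u 1) := by
      rw [bd_symmDiff, hL', bd_singleton, hu]
      calc _ = T + (Finsupp.single s 1 + Finsupp.single u 1) + (Finsupp.single b 1 + Finsupp.single b 1) := by abel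
        _ = _ := by rw [z2, add_zero]
    have h2 := hmin' u _ h1
    have h3 : symmDiff L' {e} = L'.erase e := by
      ext x; simp [Finset.mem_symmDiff]
      by_cases hx : x = e
      · subst hx; simp [he]
      · simp [hx]
    rw [h3] at h2
    have h4 := Finset.sum_erase_add L' c he
    have := hpos e hnl
    linarith
  have hphi : phi S (bd p q L) = 0 := by
    by_contra h
    obtain ⟨e, he, hc⟩ := phi_bd_ne p q S L h
    exact hc (clA L hbL' rfl e he)
  have hphiT : ∀ U : V →₀ ZMod 2, phi S U = U b := by
    intro U
    induction U using Finsupp.induction_linear with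
    | zero => simp
    | add f g hf hg => simp [hf, hg]
    | single a r => rw [phi_single, Finsupp.single_apply]; simp [S]
  have hTb : phi S T = 1 := by
    rw [hbL', map_add, phi_pair] at hphi
    by_cases hsb : s = b
    · rw [hphiT, ← hsb, hs1] at hphi
      simp at hphi
    · rw [if_pos (by simp [S, hsb])] at hphi
      have : ∀ a : ZMod 2, a + 1 = 0 → a = 1 := by decide
      exact this _ hphi
  -- claim B
  have clB : ∀ J, bd p q J = T → (∀ A, bd p q A = T → ∑ e ∈ J, c e ≤ ∑ e ∈ A, c e) →
      ∀ e1 ∈ J, ∀ e2 ∈ J, S (p e1) ≠ S (q e1) → S (p e2) ≠ S (q e2) → e1 = e2 := by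
    intro J hJ hJm e1 h1 e2 h2 hc1 hc2
    by_contra hne
    have hJL : bd p q (symmDiff J L) = Finsupp.single s 1 + Finsupp.single b 1 := by
      rw [bd_symmDiff, hJ, hbL', ← add_assoc, z2, zero_add]
    obtain ⟨P, hP, hPb, hP1⟩ := path_lemma p q _ s b hJL
    set C := symmDiff J L \ P with hC
    have hCs : C = symmDiff (symmDiff J L) P := by
      rw [symmDiff_of_ge hP]
    have hCb : bd p q C = 0 := by
      rw [hCs, bd_symmDiff, hJL, hPb, z2]
    have i1 := hJm (symmDiff J C) (by rw [bd_symmDiff, hCb, hJ, add_zero])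
    have hLC : bd p q (symmDiff L C) = T + (Finsupp.single s 1 + Finsupp.single b 1) := by
      rw [bd_symmDiff, hCb, hbL', add_zero]
    have i2 := hmin' b (symmDiff L C) hLC
    have i3 : ∑ e ∈ symmDiff J C, c e + ∑ e ∈ symmDiff L C, c e = ∑ e ∈ J, c e + ∑ e ∈ L, c e := by
      have hh : ∀ A : Finset E, ∑ e ∈ A, c e = ∑ e, if e ∈ A then c e else 0 := by
        intro A; simp
      rw [hh, hh, hh J, hh L, ← Finset.sum_add_distrib, ← Finset.sum_add_distrib]
      refine Finset.sum_congr rfl fun e _ => ?_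
      have hCsub : e ∈ C → (e ∈ J ∧ e ∉ L ∨ e ∈ L ∧ e ∉ J) := fun h =>
        Finset.mem_symmDiff.1 (Finset.mem_sdiff.1 h).1
      simp only [Finset.mem_symmDiff]
      by_cases x3 : e ∈ C
      · rcases hCsub x3 with ⟨x1, x2⟩ | ⟨x1, x2⟩
        · simp only [x1, x2, x3]; simp
        · simp only [x1, x2, x3]; simp
      · simp only [x3]; simp
    have hA := clA _ hLC (by linarith)
    have fin : ∀ e ∈ J, S (p e) ≠ S (q e) → e ∈ P := by
      intro e he hc
      by_contra heP
      have heL : e ∉ L := fun h => hc (clA L hbL' rfl e h)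
      have heC : e ∈ C := Finset.mem_sdiff.2 ⟨Finset.mem_symmDiff.2 (Or.inl ⟨he, heL⟩), heP⟩
      exact hc (hA e (Finset.mem_symmDiff.2 (Or.inr ⟨heC, heL⟩)))
    exact hne (hP1 e1 (fin e1 h1 hc1) e2 (fin e2 h2 hc2) hc1 hc2)
  -- sum split
  have hsum : ∀ (A : Finset E) (t : ℝ), ∑ e ∈ A, (c e - if S (p e) ≠ S (q e) then t else 0)
      = ∑ e ∈ A, c e - ((A.filter (fun e => S (p e) ≠ S (q e))).card : ℝ) * t := by
    intro A t
    rw [Finset.sum_sub_distrib, ← Finset.sum_filter, Finset.sum_const, nsmul_eq_mul]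
  have ev : ∀ᶠ t in nhdsWithin (0 : ℝ) (Set.Ioi 0), 0 < t ∧ (∀ e, S (p e) ≠ S (q e) → t ≤ c e) ∧ t ≤ M ∧
      ∀ A, bd p q A = T → M - t ≤ ∑ e ∈ A, (c e - if S (p e) ≠ S (q e) then t else 0) := by
    have small : ∀ r : ℝ, 0 < r → ∀ᶠ t in nhdsWithin (0 : ℝ) (Set.Ioi 0), t ≤ r := fun r hr =>
      mem_nhdsWithin_of_mem_nhds (Iic_mem_nhds hr)
    refine (eventually_mem_nhdsWithin).and (Filter.Eventually.and ?_ ((small M hM).and ?_))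
    · refine Filter.eventually_all.2 fun e => ?_
      by_cases h : S (p e) ≠ S (q e)
      · filter_upwards [small (c e) (hpos e (fun h' => h (by rw [h'])))] with t ht _ using ht
      · exact Filter.Eventually.of_forall fun t h' => absurd h' h
    · refine Filter.eventually_all.2 fun A => ?_
      by_cases hA : bd p q A = T
      swap
      · exact Filter.Eventually.of_forall fun t h' => absurd h' hA
      by_cases hm : ∀ A', bd p q A' = T → ∑ e ∈ A, c e ≤ ∑ e ∈ A', c e
      · filter_upwards [eventually_mem_nhdsWithin] with t ht _
        have ht' : 0 < t := ht
        rw [hsum]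
        have hcard : (A.filter (fun e => S (p e) ≠ S (q e))).card ≤ 1 := by
          rw [Finset.card_le_one]
          intro a ha b hb
          rw [Finset.mem_filter] at ha hb
          exact clB A hA hm a ha.1 b hb.1 ha.2 hb.2
        have : ((A.filter (fun e => S (p e) ≠ S (q e))).card : ℝ) ≤ 1 := by exact_mod_cast hcard
        have := hT A hA
        nlinarith
      · push Not at hm
        obtain ⟨A', hA', hlt⟩ := hm
        have hgap : 0 < ∑ e ∈ A, c e - M := by have := hT A' hA'; linarith
        set k := ((A.filter (fun e => S (p e) ≠ S (q e))).card : ℝ) with hk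
        have hk0 : 0 ≤ k := by positivity
        filter_upwards [eventually_mem_nhdsWithin, small ((∑ e ∈ A, c e - M) / (k + 1)) (by positivity)] with t ht ht2 _
        have ht' : 0 < t := ht
        rw [hsum]
        rw [le_div_iff₀ (by positivity)] at ht2
        nlinarith
  obtain ⟨t, h1, h2, h3, h4⟩ := ev.exists
  exact ⟨S, t, h1, hTb, h2, h3, h4⟩

open Classical in
/-- load of a cut packing on an edge -/
noncomputable def load {V E : Type*} [Fintype V] (p q : E → V) (y : (V → Bool) → ℝ) (e : E) : ℝ :=
  ∑ S : V → Bool, if S (p e) ≠ S (q e) then y S else 0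

theorem load_add {V E : Type*} [Fintype V] (p q : E → V) (y y' : (V → Bool) → ℝ) (e : E) :
    load p q (y + y') e = load p q y e + load p q y' e := by
  classical
  unfold load
  rw [← Finset.sum_add_distrib]
  refine Finset.sum_congr rfl fun S _ => ?_
  split_ifs <;> simp

open Classical in
theorem load_single {V E : Type*} [Fintype V] (p q : E → V) (S : V → Bool) (t : ℝ) (e : E) :
    load p q (Pi.single S t) e = if S (p e) ≠ S (q e) then t else 0 := by
  unfold load
  rw [Finset.sum_eq_single S]
  · simp
  · intro S' _ h
    simp [Pi.single_eq_of_ne h]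
  · simp

theorem merge_lemma {V : Type*} [DecidableEq V] (a b : V) (s : V →₀ ZMod 2)
    (h : s.mapDomain (fun v => if v = a then b else v) = 0) :
    s = 0 ∨ s = Finsupp.single a 1 + Finsupp.single b 1 := by
  have key : ∀ s : V →₀ ZMod 2, s.mapDomain (fun v => if v = a then b else v)
      = s + (Finsupp.single a (s a) + Finsupp.single b (s a)) := by
    intro s
    induction s using Finsupp.induction_linear with
    | zero => simp
    | add f g hf hg =>
      rw [Finsupp.mapDomain_add, hf, hg]
      simp only [Finsupp.add_apply, Finsupp.single_add]
      abel
    | single v r =>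
      rw [Finsupp.mapDomain_single]
      by_cases hv : v = a
      · subst hv
        simp only [if_true, Finsupp.single_eq_same]
        rw [← add_assoc, z2, zero_add]
      · simp [hv]
  rw [key] at h
  have h2 : s = Finsupp.single a (s a) + Finsupp.single b (s a) := by
    calc s = s + ((Finsupp.single a (s a) + Finsupp.single b (s a)) +
          (Finsupp.single a (s a) + Finsupp.single b (s a))) := by rw [z2, add_zero]
      _ = _ := by rw [← add_assoc, h, zero_add]
  have h3 : ∀ r : ZMod 2, r = 0 ∨ r = 1 := by decide
  rcases h3 (s a) with h4 | h4
  · left; rw [h2, h4]; simp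
  · right; rw [h4] at h2; exact h2

open Classical in
theorem pack {V E : Type*} [Fintype V] [Fintype E] (n : ℕ) : ∀ (p q : E → V) (c : E → ℝ)
    (T : V →₀ ZMod 2) (M : ℝ), (Finset.univ.filter (fun e => p e ≠ q e)).card = n →
    (∀ e, 0 ≤ c e) → 0 ≤ M →
    (∃ A, bd p q A = T) → (∀ A, bd p q A = T → M ≤ ∑ e ∈ A, c e) →
    ∃ y : (V → Bool) → ℝ, (∀ S, 0 ≤ y S) ∧ (∀ S, phi S T ≠ 1 → y S = 0) ∧
      (∀ e, load p q y e ≤ c e) ∧ ∑ S, y S = M := by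
  induction n using Nat.strong_induction_on with
  | _ n ih =>
  intro p q c T M hn hc hM hJ hT
  let K : Set ((V → Bool) → ℝ) := {y | (∀ S, 0 ≤ y S) ∧ (∀ S, phi S T ≠ 1 → y S = 0) ∧
      (∀ e, load p q y e ≤ c e) ∧ ∑ S, y S ≤ M ∧
      ∀ A, bd p q A = T → M - ∑ S, y S ≤ ∑ e ∈ A, (c e - load p q y e)}
  have hload : ∀ e, Continuous (fun y : (V → Bool) → ℝ => load p q y e) := by
    intro e
    unfold load
    refine continuous_finsetSum _ fun S _ => ?_
    split_ifs
    · exact continuous_apply S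
    · exact continuous_const
  have hK : IsCompact K := by
    refine (isCompact_Icc (a := (0 : (V → Bool) → ℝ)) (b := fun _ => M)).of_isClosed_subset ?_ ?_
    · have e1 : IsClosed {y : (V → Bool) → ℝ | ∀ S, 0 ≤ y S} := by
        rw [Set.ofPred_forall]
        exact isClosed_iInter fun S => isClosed_le continuous_const (continuous_apply S)
      have e2 : IsClosed {y : (V → Bool) → ℝ | ∀ S, phi S T ≠ 1 → y S = 0} := by
        simp only [Set.ofPred_forall]
        exact isClosed_iInter fun S => isClosed_iInter fun _ =>
          isClosed_eq (continuous_apply S) continuous_const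
      have e3 : IsClosed {y : (V → Bool) → ℝ | ∀ e, load p q y e ≤ c e} := by
        simp only [Set.ofPred_forall]
        exact isClosed_iInter fun e => isClosed_le (hload e) continuous_const
      have e4 : IsClosed {y : (V → Bool) → ℝ | ∑ S, y S ≤ M} :=
        isClosed_le (by fun_prop) continuous_const
      have e5 : IsClosed {y : (V → Bool) → ℝ |
          ∀ A, bd p q A = T → M - ∑ S, y S ≤ ∑ e ∈ A, (c e - load p q y e)} := by
        simp only [Set.ofPred_forall]
        refine isClosed_iInter fun A => isClosed_iInter fun _ =>
          isClosed_le (by fun_prop) ?_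
        exact continuous_finsetSum _ fun e _ => continuous_const.sub (hload e)
      exact e1.inter (e2.inter (e3.inter (e4.inter e5)))
    · rintro y ⟨h1, -, -, h4, -⟩
      exact ⟨h1, fun S => (Finset.single_le_sum (fun S _ => h1 S) (Finset.mem_univ S)).trans h4⟩
  have hK0 : K.Nonempty := by
    refine ⟨0, fun S => le_rfl, fun S _ => rfl, fun e => ?_, by simpa using hM, fun A hA => ?_⟩
    · simpa [load] using hc e
    · simpa [load] using hT A hA
  obtain ⟨y, ⟨y1, y2, y3, y4, y5⟩, hmax⟩ := hK.exists_isMaxOn hK0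
    (f := fun y : (V → Bool) → ℝ => ∑ S, y S) (by fun_prop)
  rcases y4.eq_or_lt with heq | hlt
  · exact ⟨y, y1, y2, y3, heq⟩
  set c' : E → ℝ := fun e => c e - load p q y e with hc'
  have hc'0 : ∀ e, 0 ≤ c' e := fun e => sub_nonneg.2 (y3 e)
  by_cases hz : ∃ e, p e ≠ q e ∧ c' e = 0
  · obtain ⟨e0, hne, h0⟩ := hz
    let π : V → V := fun v => if v = p e0 then q e0 else v
    have hbd : ∀ A, bd (π ∘ p) (π ∘ q) A = (bd p q A).mapDomain π := by
      intro A
      unfold bd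
      rw [Finsupp.mapDomain_finsetSum]
      refine Finset.sum_congr rfl fun e _ => ?_
      rw [Finsupp.mapDomain_add, Finsupp.mapDomain_single, Finsupp.mapDomain_single]; rfl
    obtain ⟨J0, hJ0⟩ := hJ
    obtain ⟨y', a1, a2, a3, a4⟩ := ih _ (by
      rw [← hn]
      refine Finset.card_lt_card ?_
      rw [Finset.ssubset_iff_of_subset]
      · refine ⟨e0, by simpa using hne, ?_⟩
        simp [π]
      · intro e he
        rw [Finset.mem_filter] at he ⊢
        refine ⟨he.1, fun h => he.2 ?_⟩
        simp [h]) (π ∘ p) (π ∘ q) c' (T.mapDomain π) (M - ∑ S, y S) rfl hc'0 (by linarith)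
        ⟨J0, by rw [hbd, hJ0]⟩ (by
          intro A hA
          rw [hbd] at hA
          have h1 : (bd p q A + T).mapDomain π = 0 := by
            rw [Finsupp.mapDomain_add, hA, z2]
          rcases merge_lemma _ _ _ h1 with h2 | h2
          · have : bd p q A = T := by
              calc bd p q A = bd p q A + (T + T) := by rw [z2, add_zero]
                _ = T := by rw [← add_assoc, h2, zero_add]
            exact y5 A this
          · have : bd p q (symmDiff A {e0}) = T := by
              rw [bd_symmDiff, bd_singleton, ← h2, ← add_assoc, z2, zero_add]
            refine (y5 _ this).trans ?_
            change ∑ e ∈ symmDiff A {e0}, c' e ≤ ∑ e ∈ A, c' e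
            calc ∑ e ∈ symmDiff A {e0}, c' e ≤ ∑ e ∈ insert e0 A, c' e := by
                  refine Finset.sum_le_sum_of_subset_of_nonneg ?_ fun e _ _ => hc'0 e
                  intro e he
                  rw [Finset.mem_symmDiff] at he
                  simp at he ⊢
                  tauto
              _ = ∑ e ∈ A, c' e := by
                  by_cases h : e0 ∈ A
                  · rw [Finset.insert_eq_self.2 h]
                  · rw [Finset.sum_insert h, h0, zero_add])
    let y'' : (V → Bool) → ℝ := fun S => ∑ S1 : V → Bool, if S1 ∘ π = S then y' S1 else 0
    have hsum : ∀ g : (V → Bool) → ℝ, ∑ S, y'' S * g S = ∑ S1, y' S1 * g (S1 ∘ π) := by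
      intro g
      simp only [y'', Finset.sum_mul]
      rw [Finset.sum_comm]
      refine Finset.sum_congr rfl fun S1 _ => ?_
      simp [ite_mul]
    refine ⟨y + y'', fun S => ?_, fun S hS => ?_, fun e => ?_, ?_⟩
    · exact add_nonneg (y1 S) (Finset.sum_nonneg fun S1 _ => by
        split_ifs
        · exact a1 S1
        · exact le_rfl)
    · have : y'' S = 0 := by
        refine Finset.sum_eq_zero fun S1 _ => ?_
        split_ifs with h
        · apply a2
          rw [phi_mapDomain, h]; exact hS
        · rfl
      simp [this, y2 S hS]
    · rw [load_add]
      have : load p q y'' e = load (π ∘ p) (π ∘ q) y' e := by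
        have := hsum (fun S => if S (p e) ≠ S (q e) then 1 else 0)
        simpa [load, mul_ite] using this
      have h3 := a3 e
      rw [this]
      simp only [hc'] at h3
      linarith
    · have := hsum (fun S => 1)
      simp only [mul_one] at this
      simp only [Pi.add_apply, Finset.sum_add_distrib, this, a4]
      ring
  · push Not at hz
    obtain ⟨S, t, t0, s1, s2, s3, s4⟩ := star_step p q c' T (M - ∑ S, y S) (by linarith)
      (fun e he => lt_of_le_of_ne (hc'0 e) (Ne.symm (hz e he))) hJ (fun A hA => y5 A hA)
    have hs : ∑ S', (y + Pi.single S t : (V → Bool) → ℝ) S' = ∑ S', y S' + t := by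
      simp [Finset.sum_add_distrib]
    have hmem : (y + Pi.single S t : (V → Bool) → ℝ) ∈ K := by
      refine ⟨fun S' => ?_, fun S' hS' => ?_, fun e => ?_, ?_, fun A hA => ?_⟩
      · refine add_nonneg (y1 S') ?_
        by_cases h : S' = S
        · subst h; simp [t0.le]
        · simp [Pi.single_eq_of_ne h]
      · have h : S' ≠ S := by rintro rfl; exact hS' s1
        simp [Pi.single_eq_of_ne h, y2 S' hS']
      · rw [load_add, load_single]
        split_ifs with h
        · have := s2 e h
          simp only [hc'] at this
          linarith
        · simpa using y3 e
      · rw [hs]; linarith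
      · rw [hs]
        have := s4 A hA
        calc _ = M - ∑ S, y S - t := by ring
          _ ≤ _ := this
          _ = _ := by
            refine Finset.sum_congr rfl fun e _ => ?_
            rw [load_add, load_single]; simp only [hc']; ring
    have := hmax hmem
    simp only [Set.mem_ofPred_eq, hs] at this
    linarith

open Classical in
/-- Eulerian orientation -/
theorem orient {V E : Type*} (n : ℕ) : ∀ (A : Finset E) (p q : E → V), A.card = n →
    bd p q A = 0 → ∃ σ : E → ℝ, (∀ e, σ e = 1 ∨ σ e = -1) ∧
      ∀ g : V → ℝ, ∑ e ∈ A, σ e * (g (p e) - g (q e)) = 0 := by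
  induction n with
  | zero =>
    intro A p q hA _
    rw [Finset.card_eq_zero] at hA
    exact ⟨fun _ => 1, fun _ => Or.inl rfl, fun g => by simp [hA]⟩
  | succ n ih =>
    intro A p q hA hb
    by_cases hl : ∀ e ∈ A, p e = q e
    · refine ⟨fun _ => 1, fun _ => Or.inl rfl, fun g => ?_⟩
      exact Finset.sum_eq_zero fun e he => by rw [hl e he]; simp
    push Not at hl
    obtain ⟨e, he, hne⟩ := hl
    have hsplit : ∀ p q : E → V, bd p q A =
        (Finsupp.single (p e) 1 + Finsupp.single (q e) 1) + bd p q (A.erase e) := by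
      intro p q
      unfold bd; rw [← Finset.add_sum_erase A _ he]
    have h1 : bd p q (A.erase e) = Finsupp.single (p e) 1 + Finsupp.single (q e) 1 := by
      rw [hsplit] at hb
      calc bd p q (A.erase e) = (Finsupp.single (p e) 1 + Finsupp.single (q e) 1) +
          ((Finsupp.single (p e) 1 + Finsupp.single (q e) 1) + bd p q (A.erase e)) := by
            rw [← add_assoc, z2, zero_add]
        _ = _ := by rw [hb, add_zero]
    obtain ⟨e', he', hcr⟩ := phi_bd_ne p q (fun v => decide (v = q e)) (A.erase e) (by
      rw [h1, phi_pair, if_pos]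
      · simp
      · simp [hne])
    have hee : e' ≠ e := (Finset.mem_erase.1 he').1
    have he'A : e' ∈ A := (Finset.mem_erase.1 he').2
    -- the other end
    have key : ∃ w, ∃ τ : ℝ, (τ = 1 ∨ τ = -1) ∧
        (Finsupp.single (p e') (1 : ZMod 2) + Finsupp.single (q e') 1
          = Finsupp.single (q e) 1 + Finsupp.single w 1) ∧
        ∀ g : V → ℝ, τ * (g (p e') - g (q e')) = g (q e) - g w := by
      by_cases hp : p e' = q e
      · exact ⟨q e', 1, Or.inl rfl, by rw [hp], fun g => by rw [hp]; ring⟩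
      · have hq : q e' = q e := by
          by_contra hq; simp [hp, hq] at hcr
        exact ⟨p e', -1, Or.inr rfl, by rw [hq, add_comm], fun g => by rw [hq]; ring⟩
    obtain ⟨w, τ, hτ, hw, hg⟩ := key
    have heE : e ∈ A.erase e' := Finset.mem_erase.2 ⟨hee.symm, he⟩
    obtain ⟨σ, hσ, hσg⟩ := ih (A.erase e') p (Function.update q e w)
      (by rw [Finset.card_erase_of_mem he'A, hA]; rfl) (by
        have h2 : bd p (Function.update q e w) (A.erase e') =
            (Finsupp.single (p e) 1 + Finsupp.single w 1) + bd p q ((A.erase e').erase e) := by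
          unfold bd
          rw [← Finset.add_sum_erase _ _ heE]
          congr 1
          · simp
          · refine Finset.sum_congr rfl fun x hx => ?_
            rw [Function.update_of_ne (Finset.mem_erase.1 hx).1]
        have h3 : bd p q A = (Finsupp.single (p e') 1 + Finsupp.single (q e') 1) +
            ((Finsupp.single (p e) 1 + Finsupp.single (q e) 1) + bd p q ((A.erase e').erase e)) := by
          unfold bd
          rw [← Finset.add_sum_erase A _ he'A, ← Finset.add_sum_erase _ _ heE]
        rw [h2, ← hb, h3, hw]
        calc _ = (Finsupp.single (q e) (1 : ZMod 2) + Finsupp.single (q e) 1) +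
            ((Finsupp.single (p e) 1 + Finsupp.single w 1) + bd p q ((A.erase e').erase e)) := by
              rw [z2, zero_add]
          _ = _ := by abel)
    refine ⟨Function.update σ e' (σ e * τ), fun x => ?_, fun g => ?_⟩
    · by_cases hx : x = e'
      · subst hx
        rw [Function.update_self]
        rcases hσ e with h | h <;> rcases hτ with h' | h' <;> rw [h, h'] <;> norm_num
      · rw [Function.update_of_ne hx]; exact hσ x
    · have := hσg g
      rw [← Finset.add_sum_erase _ _ heE, Function.update_self] at this
      rw [← Finset.add_sum_erase A _ he'A, ← Finset.add_sum_erase _ _ heE, Function.update_self,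
        Function.update_of_ne hee.symm, mul_assoc, hg]
      have h4 : ∑ x ∈ (A.erase e').erase e, Function.update σ e' (σ e * τ) x * (g (p x) - g (q x))
          = ∑ x ∈ (A.erase e').erase e, σ x * (g (p x) - g (Function.update q e w x)) := by
        refine Finset.sum_congr rfl fun x hx => ?_
        rw [Function.update_of_ne (Finset.mem_erase.1 hx).1,
          Function.update_of_ne (Finset.mem_erase.1 (Finset.mem_erase.1 hx).2).1]
      rw [h4]
      linarith

open Classical in
theorem finite_core {V I : Type*} [Fintype V] [Fintype I] (d : V → V → ℝ) (hd : ∀ a b, 0 ≤ d a b)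
    (x y : I → V)
    (h : ∀ ε : I → ℝ, (∀ i, ε i = 1 ∨ ε i = -1) → ∀ K : ℝ, 1 < K → ∃ g : V → ℝ,
      (∀ a b, |g a - g b| ≤ K * d a b) ∧ ∀ i, g (x i) - g (y i) = ε i * d (x i) (y i)) :
    ∃ f : I → V → ℝ, (∀ i, f i (x i) - f i (y i) = d (x i) (y i)) ∧
      ∀ a b, ∑ i, |f i a - f i b| ≤ d a b := by
  let p : V × V → V := Prod.fst
  let q : V × V → V := Prod.snd
  let T : V →₀ ZMod 2 := ∑ i : I, (Finsupp.single (x i) 1 + Finsupp.single (y i) 1)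
  have hJ : ∀ s : Finset I, ∃ A, bd p q A = ∑ i ∈ s, (Finsupp.single (x i) 1 + Finsupp.single (y i) 1) := by
    intro s
    induction s using Finset.induction_on with
    | empty => exact ⟨∅, by simp [bd]⟩
    | insert i s hi ih =>
      obtain ⟨A, hA⟩ := ih
      refine ⟨symmDiff {(x i, y i)} A, ?_⟩
      rw [bd_symmDiff, hA, bd_singleton, Finset.sum_insert hi]
  have hT : ∀ A, bd p q A = T → ∑ i, d (x i) (y i) ≤ ∑ e ∈ A, d e.1 e.2 := by
    intro A hA
    let P : (V × V) ⊕ I → V := Sum.elim p x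
    let Q : (V × V) ⊕ I → V := Sum.elim q y
    obtain ⟨σ, hσ, hσg⟩ := orient _ (A.disjSum Finset.univ) P Q rfl (by
      have : bd P Q (A.disjSum Finset.univ) = bd p q A + T := by
        unfold bd; rw [Finset.sum_disjSum]; rfl
      rw [this, hA, z2])
    have hK : ∀ K : ℝ, 1 < K → ∑ i, d (x i) (y i) ≤ K * ∑ e ∈ A, d e.1 e.2 := by
      intro K hK
      obtain ⟨g, g1, g2⟩ := h (fun i => σ (Sum.inr i)) (fun i => hσ _) K hK
      have h1 := hσg g
      rw [Finset.sum_disjSum] at h1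
      have h2 : ∑ i, σ (Sum.inr i) * (g (P (Sum.inr i)) - g (Q (Sum.inr i))) = ∑ i, d (x i) (y i) := by
        refine Finset.sum_congr rfl fun i _ => ?_
        change σ (Sum.inr i) * (g (x i) - g (y i)) = _
        rw [g2]
        rcases hσ (Sum.inr i) with h | h <;> rw [h] <;> ring
      rw [h2] at h1
      have h3 : ∑ e ∈ A, -(K * d e.1 e.2) ≤ ∑ e ∈ A, σ (Sum.inl e) * (g (P (Sum.inl e)) - g (Q (Sum.inl e))) := by
        refine Finset.sum_le_sum fun e _ => ?_
        have h5 := abs_le.1 (g1 e.1 e.2)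
        change _ ≤ σ (Sum.inl e) * (g e.1 - g e.2)
        rcases hσ (Sum.inl e) with h | h <;> rw [h] <;> linarith [h5.1, h5.2]
      rw [Finset.sum_neg_distrib, ← Finset.mul_sum] at h3
      linarith
    have hs : 0 ≤ ∑ e ∈ A, d e.1 e.2 := Finset.sum_nonneg fun e _ => hd _ _
    refine le_of_forall_pos_le_add fun ε hε => ?_
    have h6 := hK (1 + ε / (∑ e ∈ A, d e.1 e.2 + 1)) (by
      have : 0 < ε / (∑ e ∈ A, d e.1 e.2 + 1) := by positivity
      linarith)
    have h7 : ε / (∑ e ∈ A, d e.1 e.2 + 1) * ∑ e ∈ A, d e.1 e.2 ≤ ε := by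
      rw [div_mul_eq_mul_div, div_le_iff₀ (by positivity)]
      nlinarith
    linarith
  obtain ⟨w, w1, w2, w3, w4⟩ := pack _ p q (fun e => d e.1 e.2) T (∑ i, d (x i) (y i)) rfl
    (fun e => hd _ _) (Finset.sum_nonneg fun i _ => hd _ _) (hJ Finset.univ) hT
  have w3' : ∀ a b, ∑ S : V → Bool, (if S a ≠ S b then w S else 0) ≤ d a b := fun a b => w3 (a, b)
  let n : (V → Bool) → ℝ := fun S => ∑ i, if S (x i) ≠ S (y i) then 1 else 0
  have hn1 : ∀ S, w S ≤ w S * n S := by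
    intro S
    by_cases hS : phi S T = 1
    · have : ∃ i, S (x i) ≠ S (y i) := by
        by_contra! hc
        have : phi S T = 0 := by
          simp only [T, map_sum]
          refine Finset.sum_eq_zero fun i _ => ?_
          rw [phi_pair, if_neg]
          simpa using hc i
        rw [this] at hS; exact zero_ne_one hS
      obtain ⟨i, hi⟩ := this
      have h1 : (1 : ℝ) ≤ n S := by
        calc (1 : ℝ) = if S (x i) ≠ S (y i) then 1 else 0 := by rw [if_pos hi]
          _ ≤ _ := Finset.single_le_sum (f := fun i => if S (x i) ≠ S (y i) then (1 : ℝ) else 0)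
              (fun j _ => by split_ifs <;> norm_num) (Finset.mem_univ i)
      exact le_mul_of_one_le_right (w1 S) h1
    · simp [w2 S hS]
  let D : I → ℝ := fun i => ∑ S : V → Bool, (if S (x i) ≠ S (y i) then w S else 0)
  have hD : ∑ i, D i = ∑ S, w S * n S := by
    simp only [D, n, Finset.mul_sum]
    rw [Finset.sum_comm]
    simp [mul_ite]
  have hDle : ∀ i, D i ≤ d (x i) (y i) := fun i => w3' _ _
  have hsw : ∑ S, w S ≤ ∑ S, w S * n S := Finset.sum_le_sum fun S _ => hn1 S
  have hDs : ∑ i, D i ≤ ∑ i, d (x i) (y i) := Finset.sum_le_sum fun i _ => hDle i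
  have hDeq : ∀ i, D i = d (x i) (y i) := by
    intro i
    exact (Finset.sum_eq_sum_iff_of_le (fun i _ => hDle i)).1 (by linarith) i (Finset.mem_univ i)
  have hneq : ∀ S, w S = w S * n S := by
    intro S
    exact (Finset.sum_eq_sum_iff_of_le (fun S _ => hn1 S)).1 (by linarith) S (Finset.mem_univ S)
  let r : Bool → ℝ := fun t => if t then 1 else 0
  have hr : ∀ s t : Bool, |r s - r t| = if s ≠ t then 1 else 0 := by
    intro s t; cases s <;> cases t <;> simp [r]
  refine ⟨fun i a => ∑ S, w S * (r (S (x i)) - r (S (y i))) * r (S a), fun i => ?_, fun a b => ?_⟩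
  · rw [← hDeq i, ← Finset.sum_sub_distrib]
    refine Finset.sum_congr rfl fun S _ => ?_
    cases S (x i) <;> cases S (y i) <;> simp [r]
  · calc ∑ i, |∑ S, w S * (r (S (x i)) - r (S (y i))) * r (S a) - ∑ S, w S * (r (S (x i)) - r (S (y i))) * r (S b)|
        ≤ ∑ i, ∑ S, w S * (if S (x i) ≠ S (y i) then 1 else 0) * (if S a ≠ S b then 1 else 0) := by
          refine Finset.sum_le_sum fun i _ => ?_
          rw [← Finset.sum_sub_distrib]
          refine (Finset.abs_sum_le_sum_abs _ _).trans (Finset.sum_le_sum fun S _ => ?_)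
          rw [← mul_sub, abs_mul, abs_mul, hr, hr, abs_of_nonneg (w1 S)]
      _ = ∑ S, w S * n S * (if S a ≠ S b then 1 else 0) := by
          rw [Finset.sum_comm]
          simp only [n, Finset.mul_sum, Finset.sum_mul]
      _ = ∑ S : V → Bool, (if S a ≠ S b then w S else 0) := by
          refine Finset.sum_congr rfl fun S _ => ?_
          rw [← hneq]; simp
      _ ≤ d a b := w3' a b

open Classical in
theorem fin_step {X : Type*} [MetricSpace X] {I : Type*} (z : X)
    (x y : I → X) (hxy : ∀ i, x i ≠ y i)
    (hinterp : ∀ α : I → ℝ, (∀ i, |α i| ≤ 1) → ∀ K : ℝ, 1 < K →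
      ∃ g : X → ℝ, g z = 0 ∧ (∀ a b : X, |g a - g b| ≤ K * dist a b) ∧
        ∀ i, (g (x i) - g (y i)) / dist (x i) (y i) = α i) (A : Finset I) (B : Finset X) :
    ∃ f : I → X → ℝ, (∀ i a, |f i a| ≤ dist a z) ∧
      (∀ i ∈ A, f i (x i) - f i (y i) = dist (x i) (y i)) ∧
      ∀ a ∈ B, ∀ b ∈ B, ∑ i ∈ A, |f i a - f i b| ≤ dist a b := by
  let C : Finset X := insert z (B ∪ (A.image x ∪ A.image y))
  have hzC : z ∈ C := by simp [C]
  have hBC : ∀ a ∈ B, a ∈ C := fun a ha => by simp [C, ha]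
  have hxC : ∀ i ∈ A, x i ∈ C := fun i hi =>
    Finset.mem_insert_of_mem (Finset.mem_union_right _ (Finset.mem_union_left _ (Finset.mem_image_of_mem x hi)))
  have hyC : ∀ i ∈ A, y i ∈ C := fun i hi =>
    Finset.mem_insert_of_mem (Finset.mem_union_right _ (Finset.mem_union_right _ (Finset.mem_image_of_mem y hi)))
  obtain ⟨f, f1, f2⟩ := finite_core (V := {v // v ∈ C}) (I := {i // i ∈ A})
    (fun a b => dist a.1 b.1) (fun a b => dist_nonneg)
    (fun i => ⟨x i.1, hxC i.1 i.2⟩) (fun i => ⟨y i.1, hyC i.1 i.2⟩) (by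
      intro ε hε K hK
      obtain ⟨g, -, g1, g2⟩ := hinterp (fun i => if h : i ∈ A then ε ⟨i, h⟩ else 0) (by
        intro i
        by_cases h : i ∈ A
        · simp only [h, dif_pos]
          rcases hε ⟨i, h⟩ with h' | h' <;> simp [h']
        · simp [h]) K hK
      refine ⟨fun a => g a.1, fun a b => g1 _ _, fun i => ?_⟩
      have := g2 i.1
      rw [div_eq_iff (dist_ne_zero.2 (hxy i.1))] at this
      simpa [i.2] using this)
  have hfl : ∀ i a b, |f i a - f i b| ≤ dist a.1 b.1 := fun i a b =>
    (Finset.single_le_sum (f := fun i => |f i a - f i b|) (fun j _ => abs_nonneg _) (Finset.mem_univ i)).trans (f2 a b)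
  let F : I → X → ℝ := fun i a => if h : i ∈ A ∧ a ∈ C then f ⟨i, h.1⟩ ⟨a, h.2⟩ - f ⟨i, h.1⟩ ⟨z, hzC⟩ else 0
  have hF : ∀ i a (hi : i ∈ A) (ha : a ∈ C), F i a = f ⟨i, hi⟩ ⟨a, ha⟩ - f ⟨i, hi⟩ ⟨z, hzC⟩ := by
    intro i a hi ha
    simp only [F]; rw [dif_pos ⟨hi, ha⟩]
  refine ⟨F, fun i a => ?_, fun i hi => ?_, fun a ha b hb => ?_⟩
  · by_cases h : i ∈ A ∧ a ∈ C
    · rw [hF i a h.1 h.2]; exact hfl _ _ _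
    · simp only [F]; rw [dif_neg h]; simp
  · rw [hF i _ hi (hxC i hi), hF i _ hi (hyC i hi)]
    have := f1 ⟨i, hi⟩
    simp only at this
    linarith
  · refine le_trans (le_of_eq ?_) (f2 ⟨a, hBC a ha⟩ ⟨b, hBC b hb⟩)
    rw [← Finset.sum_attach]
    refine Finset.sum_congr rfl fun i _ => ?_
    rw [hF i.1 a i.2 (hBC a ha), hF i.1 b i.2 (hBC b hb)]
    congr 1; ring


/-- Let `((x i, y i))_{i∈I}` be a Lipschitz interpolating set for
`Lip₀(X)` whose interpolation constant equals `1`; equivalently, the molecules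
`m_{x i, y i}` are isometrically equivalent to the unit vector basis of `ℓ₁(I)`, i.e.
`‖∑ᵢ λ i · m_{x i, y i}‖ = ∑ᵢ |λ i|` (the free-space norm being expressed by duality
against the unit ball of `Lip₀(X)`). Then there is a Beurling set `(f i)` of functions
in `Lip₀(X)` for the family; in particular (via the induced `ℓ₁(I)`-valued Lipschitz
map `w ↦ (f i w)ᵢ`, of Lipschitz norm `≤ 1`) the closed span of the molecules is
`1`-complemented in `F(X)`. -/
theorem stmt13 {X : Type*} [MetricSpace X] {I : Type*} [DecidableEq I] (z : X)
    (x y : I → X) (hxy : ∀ i, x i ≠ y i)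
    (hinterp : ∀ α : I → ℝ, (∀ i, |α i| ≤ 1) → ∀ K : ℝ, 1 < K →
      ∃ g : X → ℝ, g z = 0 ∧ (∀ a b : X, |g a - g b| ≤ K * dist a b) ∧
        ∀ i, (g (x i) - g (y i)) / dist (x i) (y i) = α i)
    (hiso : ∀ lam : I → ℝ, Summable (fun i => |lam i|) →
      sSup {r : ℝ | ∃ f : X → ℝ, f z = 0 ∧ (∀ a b : X, |f a - f b| ≤ dist a b) ∧
          r = ∑' i, lam i * ((f (x i) - f (y i)) / dist (x i) (y i))} =
        ∑' i, |lam i|) :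
    ∃ f : I → X → ℝ, (∀ i, f i z = 0) ∧
      (∀ i j, (f i (x j) - f i (y j)) / dist (x j) (y j) = if i = j then 1 else 0) ∧
      ∀ a b : X, a ≠ b →
        ∃ s : ℝ, HasSum (fun i => |f i a - f i b|) s ∧ s ≤ dist a b := by
  classical
  let box : Set (I → X → ℝ) := Set.pi Set.univ fun _ => Set.pi Set.univ fun a => Set.Icc (-dist a z) (dist a z)
  have hbox : IsCompact box := isCompact_univ_pi fun _ => isCompact_univ_pi fun a => isCompact_Icc
  let G : Finset I × Finset X → Set (I → X → ℝ) := fun w =>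
    box ∩ ({f | ∀ i ∈ w.1, f i (x i) - f i (y i) = dist (x i) (y i)} ∩
      {f | ∀ a ∈ w.2, ∀ b ∈ w.2, ∑ i ∈ w.1, |f i a - f i b| ≤ dist a b})
  have hGc : ∀ w, IsClosed (G w) := by
    intro w
    refine hbox.isClosed.inter (IsClosed.inter ?_ ?_)
    · simp only [Set.ofPred_forall]
      exact isClosed_iInter fun i => isClosed_iInter fun _ => isClosed_eq (by fun_prop) continuous_const
    · simp only [Set.ofPred_forall]
      exact isClosed_iInter fun a => isClosed_iInter fun _ => isClosed_iInter fun b =>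
        isClosed_iInter fun _ => isClosed_le (by fun_prop) continuous_const
  have hmono : ∀ w w', w ≤ w' → G w' ⊆ G w := by
    rintro w w' ⟨h1, h2⟩ f ⟨k1, k2, k3⟩
    refine ⟨k1, fun i hi => k2 i (h1 hi), fun a ha b hb => ?_⟩
    exact (Finset.sum_le_sum_of_subset_of_nonneg h1 fun _ _ _ => abs_nonneg _).trans
      (k3 a (h2 ha) b (h2 hb))
  have hne : (⋂ w, G w).Nonempty := by
    refine IsCompact.nonempty_iInter_of_directed_nonempty_isCompact_isClosed G ?_ ?_ ?_ hGc
    · intro w w'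
      exact ⟨w ⊔ w', hmono _ _ le_sup_left, hmono _ _ le_sup_right⟩
    · rintro ⟨A, B⟩
      obtain ⟨f, k1, k2, k3⟩ := fin_step z x y hxy hinterp A B
      exact ⟨f, fun i _ a _ => abs_le.1 (k1 i a), k2, k3⟩
    · intro w
      exact hbox.of_isClosed_subset (hGc w) Set.inter_subset_left
  obtain ⟨f, hf⟩ := hne
  have hf' : ∀ w, f ∈ G w := fun w => Set.mem_iInter.1 hf w
  have hz : ∀ i, f i z = 0 := by
    intro i
    have := (hf' (∅, ∅)).1 i (Set.mem_univ _) z (Set.mem_univ _)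
    simpa using this
  have hd : ∀ i, f i (x i) - f i (y i) = dist (x i) (y i) := fun i =>
    (hf' ({i}, ∅)).2.1 i (by simp)
  have hs : ∀ (A : Finset I) a b, ∑ i ∈ A, |f i a - f i b| ≤ dist a b := fun A a b =>
    (hf' (A, {a, b})).2.2 a (by simp) b (by simp)
  refine ⟨f, hz, fun i j => ?_, fun a b _ => ?_⟩
  · have hj := dist_ne_zero.2 (hxy j)
    by_cases hij : i = j
    · subst hij
      rw [hd, if_pos rfl, div_self hj]
    · rw [if_neg hij]
      have h1 := hs {i, j} (x j) (y j)
      rw [Finset.sum_pair hij, hd j, abs_of_nonneg dist_nonneg] at h1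
      have h2 : |f i (x j) - f i (y j)| ≤ 0 := by linarith
      rw [abs_nonpos_iff.1 h2, zero_div]
  · have hsm : Summable (fun i => |f i a - f i b|) :=
      summable_of_sum_le (fun i => abs_nonneg _) (fun A => hs A a b)
    exact ⟨_, hsm.hasSum, hsm.tsum_le_of_sum_le (fun A => hs A a b)⟩
end

section
/- Let X be a pointed metric space and ((x_n,y_n))_{n=1}^∞ a sequence in X² with x_n ≠ y_n and d(x_n,y_n) → 0. Then for every ε > 0 there exists a subsequence ((x_{n_k}, y_{n_k}))_{k=1}^∞ such that ‖Σ_{k=1}^∞ λ_k m_{x_{n_k},y_{n_k}}‖ ≥ (1−ε) Σ_{k=1}^∞ |λ_k| for all (λ_k) ∈ ℓ_1; consequently, the subsequence is Lipschitz interpolating for Lip_0(X) with interpolation constant at most 1/(1−ε). -/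
theorem aux_ext {X : Type*} [MetricSpace X] (f : X → ℝ) (S : Set X) (K : ℝ) (hK : 0 ≤ K)
    (h : ∀ a ∈ S, ∀ b ∈ S, |f a - f b| ≤ K * dist a b) :
    ∃ g : X → ℝ, (∀ a b, |g a - g b| ≤ K * dist a b) ∧ ∀ a ∈ S, g a = f a := by
  have h1 : LipschitzOnWith (⟨K, hK⟩ : NNReal) f S := by
    apply LipschitzOnWith.of_dist_le_mul
    intro a ha b hb
    rw [Real.dist_eq]
    exact h a ha b hb
  obtain ⟨g, hg, hfg⟩ := h1.extend_real
  refine ⟨g, fun a b => ?_, fun a ha => (hfg ha).symm⟩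
  have := hg.dist_le_mul a b
  rw [Real.dist_eq] at this
  exact this

theorem aux_sep {X : Type*} [MetricSpace X] (S : Set X) (hS : S.Finite) :
    ∃ σ : ℝ, 0 < σ ∧ ∀ p ∈ S, ∀ q ∈ S, p ≠ q → σ ≤ dist p q := by
  have h : ∀ᶠ σ in nhdsWithin (0:ℝ) (Set.Ioi 0), ∀ p ∈ S, ∀ q ∈ S, p ≠ q → σ ≤ dist p q := by
    rw [Filter.eventually_all_finite hS]
    intro p _
    rw [Filter.eventually_all_finite hS]
    intro q _
    by_cases hpq : p = q
    · simp [hpq]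
    · have : ∀ᶠ σ in nhds (0:ℝ), σ < dist p q := eventually_lt_nhds (dist_pos.2 hpq)
      filter_upwards [nhdsWithin_le_nhds this] with σ hσ _ using hσ.le
  obtain ⟨σ, h1, h2⟩ := (h.and self_mem_nhdsWithin).exists
  exact ⟨σ, h2, h1⟩

theorem aux_step {X : Type*} [MetricSpace X] (S : Set X) (hS : S.Finite) (K η : ℝ)
    (hK : 1 ≤ K) (hη : 0 < η) :
    ∃ δ : ℝ, 0 < δ ∧ ∀ x y : X, x ≠ y → dist x y < δ → ∀ α : ℝ, |α| ≤ 1 →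
      ∀ F : X → ℝ, (∀ a b, |F a - F b| ≤ K * dist a b) →
      ∃ G : X → ℝ, (∀ a b, |G a - G b| ≤ (K + η) * dist a b) ∧ (∀ a ∈ S, G a = F a) ∧
        G x - G y = α * dist x y := by
  classical
  obtain ⟨σ, hσ, hsep⟩ := aux_sep S hS
  set C : ℝ := (K + 1) / η with hC
  have hCpos : 0 < C := by positivity
  have hCη : C * η = K + 1 := by rw [hC]; field_simp
  refine ⟨η * σ / ((K + 1 + η) * (C + 1)), by positivity, ?_⟩
  intro x y hxy hd α hα F hF
  have hd0 : 0 < dist x y := dist_pos.2 hxy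
  set d := dist x y with hdd
  have hd1 : (K + 1 + η) * ((C + 1) * d) < η * σ := by
    rw [lt_div_iff₀ (by positivity)] at hd
    linarith
  have hd2 : (C + 1) * d < σ := by
    by_contra hcon
    push Not at hcon
    nlinarith
  by_cases hnear : ∃ p ∈ S, dist y p < C * d
  · obtain ⟨p, hp, hyp⟩ := hnear
    let G0 : X → ℝ := fun w => if dist w p ≤ (C + 1) * d then F p + α * (dist w y - dist p y)
      else F w
    have hxn : dist x p ≤ (C + 1) * d := by
      have := dist_triangle x y p
      linarith
    have hyn : dist y p ≤ (C + 1) * d := by linarith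
    have hGn : ∀ w, dist w p ≤ (C + 1) * d → G0 w = F p + α * (dist w y - dist p y) :=
      fun w hw => if_pos hw
    have hGf : ∀ w, ¬ dist w p ≤ (C + 1) * d → G0 w = F w := fun w hw => if_neg hw
    have hh : ∀ a b : X, |α * (dist a y - dist b y)| ≤ dist a b := by
      intro a b
      rw [abs_mul]
      have := abs_dist_sub_le a b y
      nlinarith [abs_nonneg (dist a y - dist b y), abs_nonneg α]
    have hGS : ∀ q ∈ S, G0 q = F q := by
      intro q hq
      by_cases hqn : dist q p ≤ (C + 1) * d
      · have : q = p := by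
          by_contra hne
          have := hsep q hq p hp hne
          linarith
        rw [hGn q hqn, this]; ring
      · exact hGf q hqn
    have key : ∀ w q, dist w p ≤ (C + 1) * d → ¬ dist q p ≤ (C + 1) * d → q ∈ S →
        |G0 w - G0 q| ≤ (K + η) * dist w q := by
      intro w q hw hq hqS
      rw [hGn w hw, hGf q hq]
      have hne : p ≠ q := by
        rintro rfl
        apply hq
        rw [dist_self]; positivity
      have h1 := hsep p hp q hqS hne
      have h2 := hh w p
      have h3 := hF p q
      have h4 := dist_triangle p w q
      rw [dist_comm p w] at h4
      have h5 : |F p + α * (dist w y - dist p y) - F q| ≤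
          |α * (dist w y - dist p y)| + |F p - F q| := by
        rw [show F p + α * (dist w y - dist p y) - F q =
          α * (dist w y - dist p y) + (F p - F q) by ring]
        exact abs_add_le _ _
      have h6 : K * dist p q ≤ K * (dist w p + dist w q) := by gcongr
      have h7 : (K + 1) * dist w p ≤ (K + 1) * ((C + 1) * d) := by gcongr
      have h8 : η * (σ - (C + 1) * d) ≤ η * dist w q := by
        gcongr; linarith
      nlinarith
    obtain ⟨G, hG, hGG⟩ := aux_ext G0 (S ∪ {x, y}) (K + η) (by linarith) (by
      have hcl : ∀ a ∈ S ∪ {x, y}, dist a p ≤ (C + 1) * d ∨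
          (a ∈ S ∧ ¬ dist a p ≤ (C + 1) * d) := by
        rintro a (ha | rfl | rfl)
        · by_cases h : dist a p ≤ (C + 1) * d
          · exact Or.inl h
          · exact Or.inr ⟨ha, h⟩
        · exact Or.inl hxn
        · exact Or.inl hyn
      intro a ha b hb
      have hab : 0 ≤ dist a b := dist_nonneg
      rcases hcl a ha with ha | ⟨haS, ha⟩ <;> rcases hcl b hb with hb | ⟨hbS, hb⟩
      · rw [hGn a ha, hGn b hb]
        have := hh a b
        rw [show F p + α * (dist a y - dist p y) - (F p + α * (dist b y - dist p y))
          = α * (dist a y - dist b y) by ring]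
        nlinarith
      · exact key a b ha hb hbS
      · rw [abs_sub_comm, dist_comm]
        exact key b a hb ha haS
      · rw [hGf a ha, hGf b hb]
        have := hF a b
        nlinarith)
    refine ⟨G, hG, fun a ha => ?_, ?_⟩
    · rw [hGG a (Or.inl ha), hGS a ha]
    · rw [hGG x (by simp), hGG y (by simp), hGn x hxn, hGn y hyn, dist_self]
      ring
  · push Not at hnear
    have hyS : ∀ p ∈ S, p ≠ y := by
      rintro p hp rfl
      have := hnear p hp
      rw [dist_self] at this
      nlinarith
    let G0 : X → ℝ := fun w => if w = y then F x - α * d else F w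
    have hGy : G0 y = F x - α * d := if_pos rfl
    have hGf : ∀ w, w ≠ y → G0 w = F w := fun w hw => if_neg hw
    have hαd : |α * d| ≤ d := by
      rw [abs_mul, abs_of_pos hd0]; nlinarith
    have key : ∀ w ∈ S ∪ {x, y}, w ≠ y → |G0 w - G0 y| ≤ (K + η) * dist w y := by
      intro w hw hwy
      rw [hGf w hwy, hGy]
      have h5 : |F w - (F x - α * d)| ≤ |F w - F x| + |α * d| := by
        rw [show F w - (F x - α * d) = (F w - F x) + α * d by ring]
        exact abs_add_le _ _
      rcases hw with hw | rfl | rfl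
      · have h1 := hnear w hw
        rw [dist_comm] at h1
        have h2 := hF w x
        have h3 := dist_triangle w y x
        rw [dist_comm y x] at h3
        have h4 : K * dist w x ≤ K * (dist w y + d) := by gcongr
        have h6 : η * (C * d) ≤ η * dist w y := by gcongr
        have h7 : η * (C * d) = (K + 1) * d := by rw [← hCη]; ring
        nlinarith
      · simp only [sub_self, abs_zero] at h5
        rw [← hdd]
        nlinarith
      · exact absurd rfl hwy
    obtain ⟨G, hG, hGG⟩ := aux_ext G0 (S ∪ {x, y}) (K + η) (by linarith) (by
      intro a ha b hb
      have hab : 0 ≤ dist a b := dist_nonneg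
      by_cases hay : a = y
      · by_cases hby : b = y
        · rw [hay, hby]; simp
        · rw [hay, abs_sub_comm, dist_comm]
          exact key b hb hby
      · by_cases hby : b = y
        · rw [hby]
          exact key a ha hay
        · rw [hGf a hay, hGf b hby]
          have := hF a b
          nlinarith)
    refine ⟨G, hG, fun a ha => ?_, ?_⟩
    · rw [hGG a (Or.inl ha), hGf a (hyS a ha)]
    · rw [hGG x (by simp), hGG y (by simp), hGf x hxy, hGy]
      ring

theorem aux_main {X : Type*} [MetricSpace X] (z : X) (x y : ℕ → X)
    (hxy : ∀ n, x n ≠ y n)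
    (hd : Filter.Tendsto (fun n => dist (x n) (y n)) Filter.atTop (nhds 0))
    (T : ℝ) (hT : 0 < T) :
    ∃ φ : ℕ → ℕ, StrictMono φ ∧ ∀ α : ℕ → ℝ, (∀ k, |α k| ≤ 1) →
        ∃ f : X → ℝ, f z = 0 ∧ (∀ a b : X, |f a - f b| ≤ (1 + T) * dist a b) ∧
          ∀ k, f (x (φ k)) - f (y (φ k)) = α k * dist (x (φ k)) (y (φ k)) := by
  classical
  let κ : ℕ → ℝ := fun n => 1 + T * (1 - (1 / 2) ^ n)
  let S : ℕ → Set X := fun N => x '' Set.Iio N ∪ y '' Set.Iio N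
  have hS : ∀ N, (S N).Finite := fun N =>
    ((Set.finite_Iio N).image x).union ((Set.finite_Iio N).image y)
  have hκ1 : ∀ n, 1 ≤ κ n := by
    intro n
    have : (1 / 2 : ℝ) ^ n ≤ 1 := pow_le_one₀ (by norm_num) (by norm_num)
    have : 0 ≤ T * (1 - (1 / 2) ^ n) := mul_nonneg hT.le (by linarith)
    simp only [κ]; linarith
  have hκT : ∀ n, κ n ≤ 1 + T := by
    intro n
    have : 0 ≤ T * (1 / 2 : ℝ) ^ n := by positivity
    simp only [κ]; linarith
  have hκs : ∀ n, κ n + T * (1 / 2) ^ (n + 1) = κ (n + 1) := by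
    intro n; simp only [κ]; ring
  have hstep := fun N n => aux_step (S N) (hS N) (κ n) (T * (1 / 2) ^ (n + 1)) (hκ1 n)
    (by positivity)
  choose δ hδ hstep using hstep
  have hnxt : ∀ N n, ∃ m, N ≤ m ∧ dist (x m) (y m) < δ N n := fun N n =>
    ((Filter.eventually_ge_atTop N).and (hd.eventually (eventually_lt_nhds (hδ N n)))).exists
  choose nxt hnxt1 hnxt2 using hnxt
  let φ : ℕ → ℕ := fun n => Nat.rec (nxt 0 0) (fun n p => nxt (p + 1) (n + 1)) n
  have hφs : ∀ n, φ (n + 1) = nxt (φ n + 1) (n + 1) := fun n => rfl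
  have hφ : StrictMono φ := strictMono_nat_of_lt_succ (fun n => by
    rw [hφs]; exact hnxt1 _ _)
  refine ⟨φ, hφ, fun α hα => ?_⟩
  have hG : ∀ n (F : X → ℝ), ∃ G : X → ℝ, (∀ a b, |F a - F b| ≤ κ n * dist a b) →
      (∀ a b, |G a - G b| ≤ κ (n + 1) * dist a b) ∧
      (∀ k < n, G (x (φ k)) = F (x (φ k)) ∧ G (y (φ k)) = F (y (φ k))) ∧
      G (x (φ n)) - G (y (φ n)) = α n * dist (x (φ n)) (y (φ n)) := by
    intro n F
    by_cases hF : ∀ a b, |F a - F b| ≤ κ n * dist a b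
    · have : ∃ N, dist (x (φ n)) (y (φ n)) < δ N n ∧ ∀ k < n, φ k < N := by
        cases n with
        | zero => exact ⟨0, hnxt2 0 0, by simp⟩
        | succ n =>
          refine ⟨φ n + 1, hnxt2 _ _, fun k hk => ?_⟩
          exact Nat.lt_succ_of_le (hφ.monotone (Nat.le_of_lt_succ hk))
      obtain ⟨N, h1, h2⟩ := this
      obtain ⟨G, g1, g2, g3⟩ := hstep N n _ _ (hxy (φ n)) h1 (α n) (hα n) F hF
      refine ⟨G, fun _ => ⟨?_, fun k hk => ⟨g2 _ ?_, g2 _ ?_⟩, g3⟩⟩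
      · rw [← hκs]; exact g1
      · exact Or.inl ⟨φ k, h2 k hk, rfl⟩
      · exact Or.inr ⟨φ k, h2 k hk, rfl⟩
    · exact ⟨F, fun h => absurd h hF⟩
  choose G hG using hG
  let F : ℕ → X → ℝ := fun n => Nat.rec (fun _ => 0) (fun n p => G n p) n
  have hFs : ∀ n, F (n + 1) = G n (F n) := fun n => rfl
  have hFL : ∀ n a b, |F n a - F n b| ≤ κ n * dist a b := by
    intro n
    induction n with
    | zero =>
      intro a b
      have : 0 ≤ κ 0 * dist a b := mul_nonneg (by linarith [hκ1 0]) dist_nonneg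
      simpa [F] using this
    | succ n ih => rw [hFs]; exact (hG n (F n) ih).1
  have hFst : ∀ k m, k + 1 ≤ m → F m (x (φ k)) = F (k + 1) (x (φ k)) ∧
      F m (y (φ k)) = F (k + 1) (y (φ k)) := by
    intro k m hm
    induction m, hm using Nat.le_induction with
    | base => exact ⟨rfl, rfl⟩
    | succ m hm ih =>
      have := (hG m (F m) (hFL m)).2.1 k hm
      rw [hFs m, this.1, this.2]
      exact ih
  let R : Set X := {w | ∃ c, ∀ᶠ m in Filter.atTop, F m w = c}
  have hc : ∀ w, ∃ c, w ∈ R → ∀ᶠ m in Filter.atTop, F m w = c := by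
    intro w
    by_cases hw : w ∈ R
    · obtain ⟨c, hc⟩ := hw
      exact ⟨c, fun _ => hc⟩
    · exact ⟨0, fun h => absurd h hw⟩
  choose c hc using hc
  obtain ⟨g, hg, hgc⟩ := aux_ext c R (1 + T) (by linarith) (by
    intro a ha b hb
    obtain ⟨m, h1, h2⟩ := ((hc a ha).and (hc b hb)).exists
    rw [← h1, ← h2]
    exact (hFL m a b).trans (mul_le_mul_of_nonneg_right (hκT m) dist_nonneg))
  refine ⟨fun w => g w - g z, sub_self _, fun a b => ?_, fun k => ?_⟩
  · simpa using hg a b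
  · have hx : x (φ k) ∈ R := ⟨F (k + 1) (x (φ k)), by
      filter_upwards [Filter.eventually_ge_atTop (k + 1)] with m hm using (hFst k m hm).1⟩
    have hy : y (φ k) ∈ R := ⟨F (k + 1) (y (φ k)), by
      filter_upwards [Filter.eventually_ge_atTop (k + 1)] with m hm using (hFst k m hm).2⟩
    obtain ⟨m, ⟨h1, h2⟩, h3⟩ := (((hc _ hx).and (hc _ hy)).and
      (Filter.eventually_ge_atTop (k + 1))).exists
    have h4 := hFst k m h3
    have h5 := (hG k (F k) (hFL k)).2.2
    rw [← hFs] at h5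
    simp only [sub_sub_sub_cancel_right]
    rw [hgc _ hx, hgc _ hy, ← h1, ← h2, h4.1, h4.2, h5]


/-- Let `X` be a pointed metric space and `((x n, y n))_{n∈ℕ}` a
sequence in `X²` with `x n ≠ y n` and `d(x n, y n) → 0`. Then for every `ε ∈ (0,1)`
there is a subsequence (given by a strictly monotone `φ`) such that
`‖∑ₖ λ k · m_{x (φ k), y (φ k)}‖ ≥ (1 − ε) ∑ₖ |λ k|` for every `λ ∈ ℓ₁` (the
free-space norm expressed by duality against the unit ball of `Lip₀(X)`);
consequently the subsequence is Lipschitz interpolating for `Lip₀(X)` with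
interpolation constant at most `1/(1−ε)`. -/
theorem stmt18 {X : Type*} [MetricSpace X] (z : X) (x y : ℕ → X)
    (hxy : ∀ n, x n ≠ y n)
    (hd : Filter.Tendsto (fun n => dist (x n) (y n)) Filter.atTop (nhds 0))
    (ε : ℝ) (hε : 0 < ε) (hε1 : ε < 1) :
    ∃ φ : ℕ → ℕ, StrictMono φ ∧
      (∀ lam : ℕ → ℝ, Summable (fun k => |lam k|) →
        (1 - ε) * ∑' k, |lam k| ≤
          sSup {r : ℝ | ∃ f : X → ℝ, f z = 0 ∧ (∀ a b : X, |f a - f b| ≤ dist a b) ∧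
            r = ∑' k, lam k *
              ((f (x (φ k)) - f (y (φ k))) / dist (x (φ k)) (y (φ k)))}) ∧
      (∀ α : ℕ → ℝ, (∀ k, |α k| ≤ 1) → ∀ K : ℝ, 1 / (1 - ε) < K →
        ∃ f : X → ℝ, f z = 0 ∧ (∀ a b : X, |f a - f b| ≤ K * dist a b) ∧
          ∀ k, (f (x (φ k)) - f (y (φ k))) / dist (x (φ k)) (y (φ k)) = α k) := by
  have h1ε : 0 < 1 - ε := by linarith
  have hT : 0 < 1 / (1 - ε) - 1 := by
    rw [sub_pos, lt_div_iff₀ h1ε]; linarith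
  obtain ⟨φ, hφ, H⟩ := aux_main z x y hxy hd _ hT
  rw [add_sub_cancel] at H
  have hpos : ∀ k, 0 < dist (x (φ k)) (y (φ k)) := fun k => dist_pos.2 (hxy _)
  refine ⟨φ, hφ, fun lam hlam => ?_, fun α hα K hK => ?_⟩
  · apply le_csSup
    · refine ⟨∑' k, |lam k|, ?_⟩
      rintro r ⟨f, -, hf, rfl⟩
      have hb : ∀ k, |lam k * ((f (x (φ k)) - f (y (φ k))) / dist (x (φ k)) (y (φ k)))|
          ≤ |lam k| := by
        intro k
        rw [abs_mul, abs_div, abs_of_pos (hpos k)]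
        exact mul_le_of_le_one_right (abs_nonneg _)
          ((div_le_one (hpos k)).2 (hf _ _))
      have hs : Summable fun k =>
          lam k * ((f (x (φ k)) - f (y (φ k))) / dist (x (φ k)) (y (φ k))) :=
        Summable.of_norm_bounded hlam hb
      exact hs.tsum_le_tsum (fun k => (le_abs_self _).trans (hb k)) hlam
    · obtain ⟨f, hz, hf, hfk⟩ := H (fun k => SignType.sign (lam k)) (fun k => by
        rcases lt_trichotomy (lam k) 0 with h | h | h <;> simp [h])
      refine ⟨fun w => (1 - ε) * f w, by simp [hz], fun a b => ?_, ?_⟩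
      · rw [← mul_sub, abs_mul, abs_of_pos h1ε]
        calc (1 - ε) * |f a - f b| ≤ (1 - ε) * (1 / (1 - ε) * dist a b) :=
              mul_le_mul_of_nonneg_left (hf a b) h1ε.le
          _ = dist a b := by field_simp
      · rw [← tsum_mul_left]
        congr 1
        ext k
        rw [← mul_sub, hfk k, ← mul_assoc, mul_div_assoc, div_self (hpos k).ne', mul_one,
          mul_left_comm, self_mul_sign]
  · obtain ⟨f, hz, hf, hfk⟩ := H α hα
    refine ⟨f, hz, fun a b => (hf a b).trans
      (mul_le_mul_of_nonneg_right hK.le dist_nonneg), fun k => ?_⟩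
    rw [hfk k, mul_div_assoc, div_self (hpos k).ne', mul_one]
end
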